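/- arXiv:2103.07445 — 2 statements merged into one kernel-verified Lean document; each statement's English description precedes it below -/
import Mathlib

section
/- Let f = G·(T_1 + T_2), where G, T_1, T_2 ∈ F[x_1,…,x_n] are products of linear forms, T_1 and T_2 are homogeneous of equal degree m ≥ 1, and T_1 and T_2 have no common linear factor (gcd(T_1,T_2) = 1). Suppose that for each i ∈ {1,2} the linear factors of T_i span an F-subspace of dimension at least log₂(m) + 5. Then every linear form dividing T_1·T_2 has a scalar multiple that is a candidate linear form for NonLin(f), i.e. every linear factor of T_1·T_2 belongs (up to scalar multiples) to L(NonLin(f)). -/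
open MvPolynomial

/-- A linear form: a nonzero homogeneous degree-1 polynomial. -/
def IsLinearForm {F : Type*} [Field F] {n : ℕ} (ℓ : MvPolynomial (Fin n) F) : Prop :=
  ℓ ≠ 0 ∧ ℓ.IsHomogeneous 1

/-- A product of linear forms (a nonzero scalar multiple of a product of linear forms). -/
def IsProdLinearForms {F : Type*} [Field F] {n : ℕ} (g : MvPolynomial (Fin n) F) : Prop :=
  ∃ (c : F) (L : Multiset (MvPolynomial (Fin n) F)),
    c ≠ 0 ∧ (∀ p ∈ L, IsLinearForm p) ∧ g = c • L.prod

/-- `g` has no linear factors. -/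
def NoLinearFactor {F : Type*} [Field F] {n : ℕ} (g : MvPolynomial (Fin n) F) : Prop :=
  ∀ ℓ : MvPolynomial (Fin n) F, IsLinearForm ℓ → ¬ ℓ ∣ g

/-- `h` is the non-linear part `NonLin(f)` of `f` (up to scalars): `h` has no linear
factors and `f` is a product of linear forms times `h`. -/
def IsNonLinPart {F : Type*} [Field F] {n : ℕ} (f h : MvPolynomial (Fin n) F) : Prop :=
  NoLinearFactor h ∧ ∃ L : MvPolynomial (Fin n) F, IsProdLinearForms L ∧ f = L * h

/-- `S(g)`: the set of codimension-2 subspaces `V(ℓ₁,ℓ₂)` of `F^n` on which `g`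
vanishes, i.e. `g` belongs to the ideal generated by `ℓ₁, ℓ₂`. -/
def vanishCodim2 {F : Type*} [Field F] {n : ℕ} (g : MvPolynomial (Fin n) F) :
    Set (Set (Fin n → F)) :=
  {W | ∃ ℓ₁ ℓ₂ : MvPolynomial (Fin n) F, IsLinearForm ℓ₁ ∧ IsLinearForm ℓ₂ ∧
    LinearIndependent F ![ℓ₁, ℓ₂] ∧
    W = {a : Fin n → F | eval a ℓ₁ = 0 ∧ eval a ℓ₂ = 0} ∧
    g ∈ Ideal.span {ℓ₁, ℓ₂}}

/-- `g` factorizes into non-zero linear forms on the hyperplane `V(ℓ)`: modulo `ℓ`, `g`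
is a nonzero scalar times a product of linear forms none of which is a multiple of `ℓ`
(so each restricts to a nonzero linear form on `V(ℓ)`). -/
def FactorsIntoLinearOn {F : Type*} [Field F] {n : ℕ} (g ℓ : MvPolynomial (Fin n) F) : Prop :=
  ∃ (c : F) (L : Multiset (MvPolynomial (Fin n) F)), c ≠ 0 ∧
    (∀ p ∈ L, IsLinearForm p ∧ p ∉ Submodule.span F ({ℓ} : Set (MvPolynomial (Fin n) F))) ∧
    g - c • L.prod ∈ Ideal.span {ℓ}

/-- `ℓ` is a candidate linear form for `g`: (i) `g` factorizes into nonzero linear forms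
on `V(ℓ)`, and (ii) there are linear forms `ℓ₁, ℓ₂` with `ℓ, ℓ₁, ℓ₂` linearly independent
such that `g` vanishes on both `V(ℓ,ℓ₁)` and `V(ℓ,ℓ₂)`. -/
def IsCandidateLinearForm {F : Type*} [Field F] {n : ℕ} (g ℓ : MvPolynomial (Fin n) F) : Prop :=
  IsLinearForm ℓ ∧ FactorsIntoLinearOn g ℓ ∧
  ∃ ℓ₁ ℓ₂ : MvPolynomial (Fin n) F, IsLinearForm ℓ₁ ∧ IsLinearForm ℓ₂ ∧
    LinearIndependent F ![ℓ, ℓ₁, ℓ₂] ∧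
    g ∈ Ideal.span {ℓ, ℓ₁} ∧ g ∈ Ideal.span {ℓ, ℓ₂}

/-- Coordinate functionals with respect to a linearly independent set. -/
lemma LinearIndepOn.exists_coords {K V : Type*} [Field K] [AddCommGroup V] [Module K V]
    {b : Set V} (hb : LinearIndepOn K id b) :
    ∃ e : V → V →ₗ[K] K, ∀ x ∈ b, ∀ y ∈ b, (x = y → e x y = 1) ∧ (x ≠ y → e x y = 0) := by
  classical
  let B := Module.Basis.extend hb
  refine ⟨fun x => if hx : x ∈ hb.extend (Set.subset_univ b) then B.coord ⟨x, hx⟩ else 0,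
    fun x hx y hy => ?_⟩
  have hx' := hb.subset_extend (Set.subset_univ b) hx
  have hy' := hb.subset_extend (Set.subset_univ b) hy
  have hBy : B ⟨y, hy'⟩ = y := Module.Basis.extend_apply_self hb ⟨y, hy'⟩
  have key : B.repr y ⟨x, hx'⟩ = if y = x then 1 else 0 := by
    conv_lhs => rw [← hBy, B.repr_self, Finsupp.single_apply]
    simp
  simp only [dif_pos hx', Module.Basis.coord_apply, key]
  constructor
  · rintro rfl; simp
  · intro h; rw [if_neg (Ne.symm h)]

/-- If a set `D` of vectors can be moved within itself by a nonzero multiple of each vector of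
an independent family `B`, then `D` meets at least `2 ^ |B|` lines. -/
lemma two_pow_card_le_of_forall_exists_add_smul_mem {K V : Type*} [Field K] [AddCommGroup V]
    [Module K V] {D : Set V} {L : Multiset V} {u : V} {B : Finset V} (huD : u ∈ D) (huB : u ∉ B)
    (hli : LinearIndepOn K id (insert u (B : Set V)))
    (hstep : ∀ w ∈ D, ∀ q ∈ B, ∃ a : K, a ≠ 0 ∧ w + a • q ∈ D)
    (hL : ∀ w ∈ D, ∃ p ∈ L, ∃ c : K, c ≠ 0 ∧ p = c • w) :
    2 ^ B.card ≤ Multiset.card L := by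
  classical
  obtain ⟨e, he⟩ := hli.exists_coords
  have hu : u ∈ insert u (B : Set V) := Set.mem_insert _ _
  have hB : ∀ i ∈ B, i ∈ insert u (B : Set V) := fun i hi => Set.mem_insert_of_mem _ hi
  have walk : ∀ A : Finset V, A ⊆ B → ∃ w ∈ D, e u w = 1 ∧ ∀ i ∈ B, e i w ≠ 0 ↔ i ∈ A := by
    intro A
    induction A using Finset.induction_on with
    | empty =>
      intro _
      refine ⟨u, huD, (he u hu u hu).1 rfl, fun i hi => ?_⟩
      have hne : i ≠ u := fun h => huB (h ▸ hi)
      simp [(he i (hB i hi) u hu).2 hne]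
    | insert q A hqA ih =>
      intro hA
      have hqB : q ∈ B := hA (Finset.mem_insert_self _ _)
      obtain ⟨w, hwD, hw1, hw⟩ := ih ((Finset.subset_insert _ _).trans hA)
      obtain ⟨a, ha, haD⟩ := hstep w hwD q hqB
      refine ⟨_, haD, ?_, fun i hi => ?_⟩
      · have hne : u ≠ q := fun h => huB (h ▸ hqB)
        simp [hw1, (he u hu q (hB q hqB)).2 hne]
      · by_cases hiq : i = q
        · subst hiq
          have h0 : e i w = 0 := by
            by_contra h
            exact hqA ((hw i hi).1 h)
          simp [h0, (he i (hB i hi) i (hB i hi)).1 rfl, ha]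
        · simp [(he i (hB i hi) q (hB q hqB)).2 hiq, hiq, ← hw i hi]
  choose! w hwD hw1 hw using walk
  choose! p hp c hc hpc using hL
  rw [← Finset.card_powerset]
  refine (Finset.card_le_card_of_injOn (t := L.toFinset) (fun A => p (w A)) ?_ ?_).trans
    L.toFinset_card_le
  · intro A hA
    have hA : A ⊆ B := by simpa using hA
    simpa using hp _ (hwD A hA)
  · intro A hA A' hA' h
    have hA : A ⊆ B := by simpa using hA
    have hA' : A' ⊆ B := by simpa using hA'
    simp only [hpc _ (hwD A hA), hpc _ (hwD A' hA')] at h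
    have hcc : c (w A) = c (w A') := by simpa [hw1 A hA, hw1 A' hA'] using congrArg (e u) h
    rw [hcc] at h
    have hww : w A = w A' := smul_right_injective V (hc _ (hwD A' hA')) h
    ext i
    by_cases hi : i ∈ B
    · rw [← hw A hA i hi, ← hw A' hA' i hi, hww]
    · exact ⟨fun h => absurd (hA h) hi, fun h => absurd (hA' h) hi⟩

/-- Pairwise dependent forms modulo `ℓ` lie in a common plane through `ℓ`. -/
lemma exists_forall_mem_span_pair {K V : Type*} [Field K] [AddCommGroup V] [Module K V] {ℓ : V}
    (hℓ : ℓ ≠ 0) {t : Set V} (ht : ∀ p ∈ t, p ∉ Submodule.span K {ℓ})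
    (h : ∀ p ∈ t, ∀ p' ∈ t, ¬ LinearIndependent K ![ℓ, p, p']) :
    ∃ p : V, ∀ p' ∈ t, p' ∈ Submodule.span K {ℓ, p} := by
  rcases t.eq_empty_or_nonempty with rfl | ⟨p, hp⟩
  · exact ⟨0, by simp⟩
  · refine ⟨p, fun p' hp' => ?_⟩
    by_contra hmem
    refine h p hp p' hp' ?_
    have h2 : LinearIndependent K ![ℓ, p] := by
      rw [LinearIndependent.pair_iff' hℓ]
      exact fun a ha => ht p hp (Submodule.mem_span_singleton.2 ⟨a, ha⟩)
    have := LinearIndependent.finSnoc (v := ![ℓ, p]) (x := p') h2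
      (by simpa [Set.pair_comm] using hmem)
    convert this using 1
    ext i
    fin_cases i <;> rfl

section LinearForms

variable {F : Type*} [Field F] {n : ℕ}

lemma exists_eq_smul_of_dvd_isHomogeneous_one {p q : MvPolynomial (Fin n) F}
    (hp : IsLinearForm p) (hq : q.IsHomogeneous 1) (h : p ∣ q) : ∃ c : F, q = c • p := by
  obtain ⟨r, rfl⟩ := h
  by_cases hr : r = 0
  · exact ⟨0, by simp [hr]⟩
  have h1 := hq.totalDegree (mul_ne_zero hp.1 hr)
  rw [totalDegree_mul_of_isDomain hp.1 hr, hp.2.totalDegree hp.1] at h1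
  refine ⟨coeff 0 r, ?_⟩
  rw [smul_eq_C_mul, mul_comm]
  congr 1
  exact totalDegree_eq_zero_iff_eq_C.1 (by omega)

lemma IsLinearForm.exists_eq_smul_of_dvd {p q : MvPolynomial (Fin n) F}
    (hp : IsLinearForm p) (hq : IsLinearForm q) (h : p ∣ q) : ∃ c : F, c ≠ 0 ∧ q = c • p := by
  obtain ⟨c, rfl⟩ := exists_eq_smul_of_dvd_isHomogeneous_one hp hq.2 h
  exact ⟨c, fun hc => hq.1 (by simp [hc]), rfl⟩

lemma IsLinearForm.smul {p : MvPolynomial (Fin n) F} (hp : IsLinearForm p) {c : F} (hc : c ≠ 0) :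
    IsLinearForm (c • p) :=
  ⟨smul_ne_zero hc hp.1, by rw [smul_eq_C_mul]; exact hp.2.C_mul c⟩

/-- The substitution projecting along a linear form `ℓ`, i.e. restriction to `V(ℓ)`. -/
lemma IsLinearForm.exists_restriction {ℓ : MvPolynomial (Fin n) F} (hℓ : IsLinearForm ℓ) :
    ∃ (φ : MvPolynomial (Fin n) F →ₐ[F] MvPolynomial (Fin n) F)
      (e : MvPolynomial (Fin n) F →ₗ[F] F),
      (∀ g, ℓ ∣ g - φ g) ∧ (∀ g, φ g = 0 ↔ ℓ ∣ g) ∧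
      ∀ p : MvPolynomial (Fin n) F, p.IsHomogeneous 1 → φ p = p - e p • ℓ := by
  obtain ⟨e', he'⟩ := LinearIndepOn.exists_coords (K := F) (b := {ℓ})
    (LinearIndepOn.singleton (R := F) (v := id) hℓ.1)
  set e := e' ℓ
  have heℓ : e ℓ = 1 := (he' ℓ rfl ℓ rfl).1 rfl
  let φ : MvPolynomial (Fin n) F →ₐ[F] MvPolynomial (Fin n) F :=
    aeval fun i => X i - e (X i) • ℓ
  have hlin : ∀ p : MvPolynomial (Fin n) F, p.IsHomogeneous 1 → φ p = p - e p • ℓ := by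
    intro p hp
    have hmem : p ∈ Submodule.span F (Set.range (X : Fin n → MvPolynomial (Fin n) F)) := by
      rw [← homogeneousSubmodule_one_eq_span_X]
      exact hp
    have : Set.EqOn φ.toLinearMap (LinearMap.id - e.smulRight ℓ :
        MvPolynomial (Fin n) F →ₗ[F] MvPolynomial (Fin n) F)
        (Submodule.span F (Set.range (X : Fin n → MvPolynomial (Fin n) F))) := by
      apply LinearMap.eqOn_span
      rintro _ ⟨i, rfl⟩
      simp [φ]
    simpa using this hmem
  have hsub : ∀ g, ℓ ∣ g - φ g := by
    intro g
    have : (Ideal.Quotient.mkₐ F (Ideal.span {ℓ})).comp φ =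
        Ideal.Quotient.mkₐ F (Ideal.span {ℓ}) := by
      ext i
      simp only [AlgHom.comp_apply, Ideal.Quotient.mkₐ_eq_mk, φ, aeval_X]
      rw [Ideal.Quotient.eq, Ideal.mem_span_singleton, sub_sub_cancel_left, smul_eq_C_mul,
        dvd_neg]
      exact dvd_mul_left _ _
    have h := DFunLike.congr_fun this g
    simp only [AlgHom.comp_apply, Ideal.Quotient.mkₐ_eq_mk] at h
    rw [← Ideal.mem_span_singleton]
    exact Ideal.Quotient.eq.1 h.symm
  refine ⟨φ, e, hsub, fun g => ⟨fun h => by simpa [h] using hsub g, ?_⟩, hlin⟩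
  rintro ⟨r, rfl⟩
  simp [hlin ℓ hℓ.2, heℓ]

lemma IsLinearForm.prime {ℓ : MvPolynomial (Fin n) F} (hℓ : IsLinearForm ℓ) : Prime ℓ := by
  obtain ⟨φ, -, -, hφ, -⟩ := hℓ.exists_restriction
  refine ⟨hℓ.1, fun hu => ?_, fun a b hab => ?_⟩
  · have := (hφ 1).2 hu.dvd
    simp at this
  · rw [← hφ, map_mul, mul_eq_zero] at hab
    simpa only [hφ] using hab

lemma IsLinearForm.not_dvd_C {ℓ : MvPolynomial (Fin n) F} (hℓ : IsLinearForm ℓ) {c : F}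
    (hc : c ≠ 0) : ¬ ℓ ∣ C c :=
  fun h => hℓ.prime.not_isUnit (isUnit_of_dvd_unit h ((isUnit_iff_ne_zero.2 hc).map C))

lemma IsLinearForm.exists_mem_dvd {ℓ : MvPolynomial (Fin n) F} (hℓ : IsLinearForm ℓ) {c : F}
    (hc : c ≠ 0) {M : Multiset (MvPolynomial (Fin n) F)} (h : ℓ ∣ C c * M.prod) :
    ∃ p ∈ M, ℓ ∣ p :=
  hℓ.prime.exists_mem_multiset_dvd ((hℓ.prime.dvd_or_dvd h).resolve_left (hℓ.not_dvd_C hc))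

/-- A divisor of a product of linear forms is a product of some of them. -/
lemma exists_le_eq_C_mul_prod_of_dvd {c : F} (hc : c ≠ 0)
    (M : Multiset (MvPolynomial (Fin n) F)) (hM : ∀ p ∈ M, IsLinearForm p)
    {g : MvPolynomial (Fin n) F} (hg : g ∣ C c * M.prod) :
    ∃ (b : F) (t : Multiset (MvPolynomial (Fin n) F)), b ≠ 0 ∧ t ≤ M ∧ g = C b * t.prod := by
  induction M using Multiset.induction_on generalizing g with
  | empty =>
    have hu : IsUnit g := isUnit_of_dvd_unit hg
      (by simpa using (isUnit_iff_ne_zero.2 hc).map (C : F →+* MvPolynomial (Fin n) F))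
    obtain ⟨b, hb, rfl⟩ := isUnit_iff_eq_C_of_isReduced.1 hu
    exact ⟨b, 0, hb.ne_zero, le_rfl, by simp⟩
  | cons q M ih =>
    have hq := hM q (Multiset.mem_cons_self _ _)
    have hM' : ∀ p ∈ M, IsLinearForm p := fun p hp => hM p (Multiset.mem_cons_of_mem hp)
    have hq0 := hq.1
    obtain ⟨x, hx⟩ := hg
    rw [Multiset.prod_cons, mul_left_comm] at hx
    rcases hq.prime.dvd_or_dvd (hx ▸ dvd_mul_right _ _ : q ∣ g * x) with ⟨g', rfl⟩ | ⟨x', rfl⟩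
    · rw [mul_assoc] at hx
      obtain ⟨b, t, hb, ht, rfl⟩ := ih hM' (g := g') ⟨x, mul_left_cancel₀ hq0 hx⟩
      exact ⟨b, q ::ₘ t, hb, Multiset.cons_le_cons _ ht, by rw [Multiset.prod_cons]; ring⟩
    · rw [mul_left_comm g] at hx
      obtain ⟨b, t, hb, ht, h⟩ := ih hM' (g := g) ⟨x', mul_left_cancel₀ hq0 hx⟩
      exact ⟨b, t, hb, ht.trans (Multiset.le_cons_self _ _), h⟩

/-- Linear factors can be cancelled against a polynomial without linear factors. -/
lemma exists_eq_C_mul_prod_mul_of_prod_mul_eq {h P : MvPolynomial (Fin n) F}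
    (hh : NoLinearFactor h) (N : Multiset (MvPolynomial (Fin n) F))
    (hN : ∀ p ∈ N, IsLinearForm p) {c : F} (hc : c ≠ 0) (M : Multiset (MvPolynomial (Fin n) F))
    (hM : ∀ p ∈ M, IsLinearForm p) (heq : N.prod * P = C c * M.prod * h) :
    ∃ (b : F) (t : Multiset (MvPolynomial (Fin n) F)), b ≠ 0 ∧ (∀ p ∈ t, IsLinearForm p) ∧
      P = C b * t.prod * h := by
  classical
  induction N using Multiset.induction_on generalizing c M with
  | empty => exact ⟨c, M, hc, hM, by simpa using heq⟩
  | cons q N ih =>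
    have hq := hN q (Multiset.mem_cons_self _ _)
    rw [Multiset.prod_cons, mul_assoc] at heq
    obtain ⟨p, hp, hqp⟩ := hq.exists_mem_dvd hc
      ((hq.prime.dvd_or_dvd (heq ▸ dvd_mul_right _ _)).resolve_right (hh q hq))
    obtain ⟨a, ha, hpa⟩ := hq.exists_eq_smul_of_dvd (hM p hp) hqp
    refine ih (fun p hp => hN p (Multiset.mem_cons_of_mem hp)) (mul_ne_zero hc ha) (M.erase p)
      (fun r hr => hM r (Multiset.mem_of_mem_erase hr)) (mul_left_cancel₀ hq.1 (heq.trans ?_))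
    rw [← Multiset.prod_erase hp, hpa, smul_eq_C_mul, C_mul]
    ring

lemma isHomogeneous_multiset_prod (M : Multiset (MvPolynomial (Fin n) F))
    (hM : ∀ p ∈ M, IsLinearForm p) : M.prod.IsHomogeneous (Multiset.card M) := by
  induction M using Multiset.induction_on with
  | empty => simpa using isHomogeneous_one (Fin n) F
  | cons q M ih =>
    rw [Multiset.prod_cons, Multiset.card_cons, add_comm]
    exact (hM q (Multiset.mem_cons_self _ _)).2.mul
      (ih fun p hp => hM p (Multiset.mem_cons_of_mem hp))

lemma card_eq_of_isHomogeneous {c : F} (hc : c ≠ 0) {M : Multiset (MvPolynomial (Fin n) F)}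
    (hM : ∀ p ∈ M, IsLinearForm p) {m : ℕ} (h : (C c * M.prod).IsHomogeneous m) :
    Multiset.card M = m := by
  have h0 : C c * M.prod ≠ 0 :=
    mul_ne_zero (C_ne_zero.2 hc) (Multiset.prod_ne_zero fun h0 => (hM 0 h0).1 rfl)
  exact ((isHomogeneous_multiset_prod M hM).C_mul c).inj_right h h0

/-- Modulo a linear factor `q` of `T₁ + T₂`, each linear factor of one gate is matched to a
linear factor of the other. -/
lemma exists_add_smul_dvd_of_dvd_add {T₁ T₂ w q : MvPolynomial (Fin n) F}
    (hT₂ : IsProdLinearForms T₂)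
    (hgcd : ∀ ℓ : MvPolynomial (Fin n) F, IsLinearForm ℓ → ℓ ∣ T₁ → ¬ ℓ ∣ T₂)
    (hw : IsLinearForm w) (hwT : w ∣ T₁) (hq : IsLinearForm q) (hqT : q ∣ T₁ + T₂) :
    ∃ a : F, a ≠ 0 ∧ IsLinearForm (w + a • q) ∧ w + a • q ∣ T₂ := by
  obtain ⟨c, M, hc, hM, rfl⟩ := hT₂
  have hqw : ¬ q ∣ w := fun h =>
    hgcd q hq (h.trans hwT) ((dvd_add_right (h.trans hwT)).1 hqT)
  obtain ⟨φ, e, -, hφ, hφlin⟩ := hq.exists_restriction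
  have lin : ∀ p, IsLinearForm p → ¬ q ∣ p → IsLinearForm (φ p) := fun p hp hqp =>
    ⟨fun h => hqp ((hφ p).1 h), by
      rw [hφlin p hp.2, smul_eq_C_mul]; exact hp.2.sub (hq.2.C_mul _)⟩
  have hφw := lin w hw hqw
  have h1 : φ T₁ + φ (c • M.prod) = 0 := by rw [← map_add]; exact (hφ _).2 hqT
  have h2 : φ w ∣ φ (c • M.prod) := by
    rw [← dvd_neg, ← eq_neg_of_add_eq_zero_left h1]
    exact map_dvd φ hwT
  rw [map_smul, map_multiset_prod, smul_eq_C_mul] at h2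
  obtain ⟨p, hp, hwp⟩ := hφw.exists_mem_dvd hc h2
  obtain ⟨v, hv, rfl⟩ := Multiset.mem_map.1 hp
  have hvT : v ∣ c • M.prod := by
    rw [smul_eq_C_mul]; exact (Multiset.dvd_prod hv).mul_left _
  have hqv : ¬ q ∣ v := fun h =>
    hgcd q hq ((dvd_add_left (h.trans hvT)).1 hqT) (h.trans hvT)
  obtain ⟨d, hd, hdv⟩ := hφw.exists_eq_smul_of_dvd (lin v (hM v hv) hqv) hwp
  rw [hφlin v (hM v hv).2, hφlin w hw.2] at hdv
  have hveq : d⁻¹ • v = w + (d⁻¹ * e v - e w) • q := by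
    have : d⁻¹ • v = d⁻¹ • (v - e v • q) + (d⁻¹ * e v) • q := by module
    rw [this, hdv, smul_smul, inv_mul_cancel₀ hd]
    module
  have hvT' : d⁻¹ • v ∣ c • M.prod := by
    rw [smul_eq_C_mul]
    exact ((isUnit_iff_ne_zero.2 (inv_ne_zero hd)).map C).mul_left_dvd.2 hvT
  refine ⟨d⁻¹ * e v - e w, fun h0 => ?_, hveq ▸ (hM v hv).smul (inv_ne_zero hd), hveq ▸ hvT'⟩
  rw [h0, zero_smul, add_zero] at hveq
  exact hgcd w hw hwT (hveq ▸ hvT')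

lemma exists_add_smul_dvd_mul_of_dvd_add {T₁ T₂ w q : MvPolynomial (Fin n) F}
    (hT₁ : IsProdLinearForms T₁) (hT₂ : IsProdLinearForms T₂)
    (hgcd : ∀ ℓ : MvPolynomial (Fin n) F, IsLinearForm ℓ → ℓ ∣ T₁ → ¬ ℓ ∣ T₂)
    (hw : IsLinearForm w) (hwT : w ∣ T₁ * T₂) (hq : IsLinearForm q) (hqT : q ∣ T₁ + T₂) :
    ∃ a : F, a ≠ 0 ∧ IsLinearForm (w + a • q) ∧ w + a • q ∣ T₁ * T₂ := by
  rcases hw.prime.dvd_or_dvd hwT with h | h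
  · obtain ⟨a, ha, hl, hd⟩ := exists_add_smul_dvd_of_dvd_add hT₂ hgcd hw h hq hqT
    exact ⟨a, ha, hl, hd.mul_left _⟩
  · obtain ⟨a, ha, hl, hd⟩ := exists_add_smul_dvd_of_dvd_add hT₁ (fun p hp h2 h1 => hgcd p hp h1 h2)
      hw h hq (add_comm T₁ T₂ ▸ hqT)
    exact ⟨a, ha, hl, hd.mul_right _⟩

/-- A set of linear factors of `T₁ + T₂` which together with a linear factor of `T₁ * T₂` is
linearly independent has at most `log₂ m + 1` elements. -/
lemma two_pow_card_le_two_mul {m : ℕ} {T₁ T₂ u : MvPolynomial (Fin n) F}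
    (hT₁ : IsProdLinearForms T₁) (hT₂ : IsProdLinearForms T₂)
    (hT₁hom : T₁.IsHomogeneous m) (hT₂hom : T₂.IsHomogeneous m)
    (hgcd : ∀ ℓ : MvPolynomial (Fin n) F, IsLinearForm ℓ → ℓ ∣ T₁ → ¬ ℓ ∣ T₂)
    (hu : IsLinearForm u) (huT : u ∣ T₁ * T₂) {B : Finset (MvPolynomial (Fin n) F)} (huB : u ∉ B)
    (hB : ∀ q ∈ B, IsLinearForm q ∧ q ∣ T₁ + T₂)
    (hli : LinearIndepOn F id (insert u (B : Set (MvPolynomial (Fin n) F)))) :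
    2 ^ B.card ≤ 2 * m := by
  have hstep : ∀ w ∈ {w | IsLinearForm w ∧ w ∣ T₁ * T₂}, ∀ q ∈ B,
      ∃ a : F, a ≠ 0 ∧ w + a • q ∈ {w | IsLinearForm w ∧ w ∣ T₁ * T₂} := fun w hw q hq =>
    exists_add_smul_dvd_mul_of_dvd_add hT₁ hT₂ hgcd hw.1 hw.2 (hB q hq).1 (hB q hq).2
  obtain ⟨c₁, M₁, hc₁, hM₁, rfl⟩ := hT₁
  obtain ⟨c₂, M₂, hc₂, hM₂, rfl⟩ := hT₂
  rw [smul_eq_C_mul] at hT₁hom hT₂hom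
  have hL : ∀ w ∈ {w | IsLinearForm w ∧ w ∣ c₁ • M₁.prod * c₂ • M₂.prod},
      ∃ p ∈ M₁ + M₂, ∃ c : F, c ≠ 0 ∧ p = c • w := by
    rintro w ⟨hw, hwT⟩
    rw [smul_mul_smul_comm, ← Multiset.prod_add, smul_eq_C_mul] at hwT
    obtain ⟨p, hp, hwp⟩ := hw.exists_mem_dvd (mul_ne_zero hc₁ hc₂) hwT
    exact ⟨p, hp, hw.exists_eq_smul_of_dvd
      ((Multiset.mem_add.1 hp).elim (hM₁ p) (hM₂ p)) hwp⟩
  refine (two_pow_card_le_of_forall_exists_add_smul_mem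
    (D := {w | IsLinearForm w ∧ w ∣ c₁ • M₁.prod * c₂ • M₂.prod}) ⟨hu, huT⟩ huB hli hstep
    hL).trans_eq ?_
  rw [Multiset.card_add, card_eq_of_isHomogeneous hc₁ hM₁ hT₁hom,
    card_eq_of_isHomogeneous hc₂ hM₂ hT₂hom, two_mul]

/-- Let `T₁ + T₂ = L h` with `L` a product of linear forms and `h` without linear factors. If the
linear factors of `T₂` span a space of dimension at least `log₂ m + 4`, then each linear factor
of `T₁` is a candidate linear form for `h`. -/
lemma isCandidateLinearForm_of_dvd {m : ℕ} {T₁ T₂ h : MvPolynomial (Fin n) F} (hm : 1 ≤ m)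
    (hT₁ : IsProdLinearForms T₁) (hT₂ : IsProdLinearForms T₂)
    (hT₁hom : T₁.IsHomogeneous m) (hT₂hom : T₂.IsHomogeneous m)
    (hgcd : ∀ ℓ : MvPolynomial (Fin n) F, IsLinearForm ℓ → ℓ ∣ T₁ → ¬ ℓ ∣ T₂)
    (hdim₂ : Real.logb 2 (m : ℝ) + 4 ≤ (Module.finrank F
      ↥(Submodule.span F {ℓ : MvPolynomial (Fin n) F | IsLinearForm ℓ ∧ ℓ ∣ T₂}) : ℝ))
    {a : F} (ha : a ≠ 0) {M : Multiset (MvPolynomial (Fin n) F)} (hM : ∀ p ∈ M, IsLinearForm p)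
    (hsum : T₁ + T₂ = C a * M.prod * h)
    {ℓ : MvPolynomial (Fin n) F} (hℓ : IsLinearForm ℓ) (hℓT : ℓ ∣ T₁) :
    IsCandidateLinearForm h ℓ := by
  classical
  have hcount := fun B => two_pow_card_le_two_mul hT₁ hT₂ hT₁hom hT₂hom hgcd hℓ
    (hℓT.mul_right T₂) (B := B)
  obtain ⟨φ, e, hφsub, hφ, hφlin⟩ := hℓ.exists_restriction
  have hℓ₂ := hgcd ℓ hℓ hℓT
  have hℓsum : ¬ ℓ ∣ T₁ + T₂ := fun hd => hℓ₂ ((dvd_add_right hℓT).1 hd)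
  have lin : ∀ p, IsLinearForm p → ¬ ℓ ∣ p → IsLinearForm (φ p) := fun p hp hqp =>
    ⟨fun h => hqp ((hφ p).1 h), by
      rw [hφlin p hp.2, smul_eq_C_mul]; exact hp.2.sub (hℓ.2.C_mul _)⟩
  have hφT : φ T₂ = C a * (M.map φ).prod * φ h := by
    rw [← zero_add (φ T₂), ← (hφ T₁).2 hℓT, ← map_add, hsum, map_mul, map_mul, map_multiset_prod]
    congr 2
    exact φ.commutes a
  have hMℓ : ∀ q ∈ M, ¬ ℓ ∣ q := fun q hq hd => hℓsum
    (hsum ▸ ((hd.trans (Multiset.dvd_prod hq)).mul_left _).mul_right _)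
  -- the restriction of `h` is a product of restrictions of linear factors of `T₂`
  obtain ⟨b, t, hb, htlin, hht⟩ : ∃ (b : F) (t : Multiset (MvPolynomial (Fin n) F)), b ≠ 0 ∧
      (∀ p ∈ t, IsLinearForm p ∧ ¬ ℓ ∣ p) ∧ φ h = C b * t.prod := by
    obtain ⟨c₂, M₂, hc₂, hM₂, rfl⟩ := hT₂
    have hM₂ℓ : ∀ v ∈ M₂, ¬ ℓ ∣ v := fun v hv hd => hℓ₂ (by
      rw [smul_eq_C_mul]; exact (hd.trans (Multiset.dvd_prod hv)).mul_left _)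
    have hlin' : ∀ p ∈ M₂.map φ, IsLinearForm p ∧ ¬ ℓ ∣ p := by
      intro p hp
      obtain ⟨v, hv, rfl⟩ := Multiset.mem_map.1 hp
      exact ⟨lin v (hM₂ v hv) (hM₂ℓ v hv), fun hd => hM₂ℓ v hv
        ((dvd_sub_left hd).1 (hφsub v))⟩
    obtain ⟨b, t, hb, ht, hht⟩ := exists_le_eq_C_mul_prod_of_dvd hc₂ (M₂.map φ)
      (fun p hp => (hlin' p hp).1) (g := φ h) (by
        rw [map_smul, map_multiset_prod, smul_eq_C_mul] at hφT
        exact hφT ▸ dvd_mul_left _ _)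
    exact ⟨b, t, hb, fun p hp => hlin' p (Multiset.mem_of_le ht hp), hht⟩
  have htspan : ∀ p ∈ t, p ∉ Submodule.span F ({ℓ} : Set (MvPolynomial (Fin n) F)) := by
    intro p hp hmem
    obtain ⟨c, rfl⟩ := Submodule.mem_span_singleton.1 hmem
    exact (htlin _ hp).2 (by rw [smul_eq_C_mul]; exact dvd_mul_left _ _)
  refine ⟨hℓ, ⟨b, t, hb, fun p hp => ⟨(htlin p hp).1, htspan p hp⟩, ?_⟩, ?_⟩
  · rw [smul_eq_C_mul, ← hht]
    exact Ideal.mem_span_singleton.2 (hφsub h)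
  have hvan : ∀ p ∈ t, h ∈ Ideal.span {ℓ, p} := by
    intro p hp
    obtain ⟨x, hx⟩ := hφsub h
    obtain ⟨y, hy⟩ : p ∣ φ h := hht ▸ (Multiset.dvd_prod hp).mul_left _
    refine Ideal.mem_span_pair.2 ⟨x, y, ?_⟩
    linear_combination -hx - hy
  by_contra! hcon
  obtain ⟨p, hp⟩ := exists_forall_mem_span_pair (K := F) hℓ.1 (t := {p | p ∈ t}) htspan
    fun p₁ h₁ p₂ h₂ hli =>
      hcon p₁ p₂ (htlin p₁ h₁).1 (htlin p₂ h₂).1 hli (hvan p₁ h₁) (hvan p₂ h₂)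
  -- all linear factors of `T₂` lie in the span of `ℓ`, `p` and the linear factors of `T₁ + T₂`
  obtain ⟨s, hsM, hℓs, hMs, hs⟩ := exists_linearIndepOn_id_extension (K := F)
    (s := {ℓ}) (t := insert ℓ {q | q ∈ M}) (LinearIndepOn.singleton (v := id) hℓ.1) (by simp)
  have hℓs : ℓ ∈ s := hℓs rfl
  have hsfin : s.Finite := ((M.toFinset.finite_toSet.subset fun q hq => by simpa using hq :
    {q | q ∈ M}.Finite).insert ℓ).subset hsM
  set B : Finset (MvPolynomial (Fin n) F) := hsfin.toFinset.erase ℓ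
  have hBs : insert ℓ (B : Set (MvPolynomial (Fin n) F)) = s := by
    simp [B, Set.insert_eq_of_mem hℓs]
  have hBcard : 2 ^ B.card ≤ 2 * m := by
    refine hcount B (Finset.notMem_erase _ _) (fun q hq => ?_) (hBs.symm ▸ hs)
    obtain ⟨hqℓ, hqs⟩ := Finset.mem_erase.1 hq
    have hqM : q ∈ M := (hsM (hsfin.mem_toFinset.1 hqs)).resolve_left hqℓ
    exact ⟨hM q hqM, hsum ▸ ((Multiset.dvd_prod hqM).mul_left _).mul_right _⟩
  set S : Finset (MvPolynomial (Fin n) F) := insert p (insert ℓ B)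
  have hS : s ⊆ S := by
    rw [← hBs]; simp [S]
  have hℓS : ℓ ∈ Submodule.span F (S : Set (MvPolynomial (Fin n) F)) :=
    Submodule.subset_span (hS hℓs)
  have hpS : p ∈ Submodule.span F (S : Set (MvPolynomial (Fin n) F)) :=
    Submodule.subset_span (by simp [S])
  have hle : Submodule.span F {ℓ : MvPolynomial (Fin n) F | IsLinearForm ℓ ∧ ℓ ∣ T₂} ≤
      Submodule.span F (S : Set (MvPolynomial (Fin n) F)) := by
    rw [Submodule.span_le]
    rintro v ⟨hv, hvT⟩
    have hℓv : ¬ ℓ ∣ v := fun hd => hℓ₂ (hd.trans hvT)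
    have hφv := lin v hv hℓv
    suffices φ v ∈ Submodule.span F (S : Set (MvPolynomial (Fin n) F)) by
      have hadd := Submodule.add_mem _ this (Submodule.smul_mem _ (e v) hℓS)
      rwa [hφlin v hv.2, sub_add_cancel] at hadd
    have main : ∀ r, IsLinearForm r → φ v ∣ r → r ∈ Submodule.span F (S : Set _) →
        φ v ∈ Submodule.span F (S : Set (MvPolynomial (Fin n) F)) := by
      intro r hr hd hrS
      obtain ⟨c, hc, rfl⟩ := hφv.exists_eq_smul_of_dvd hr hd
      exact (Submodule.smul_mem_iff _ hc).1 hrS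
    have hdvd : φ v ∣ C a * (M.map φ).prod * φ h := hφT ▸ map_dvd φ hvT
    rcases hφv.prime.dvd_or_dvd hdvd with hd | hd
    · obtain ⟨r, hr, hvr⟩ := hφv.exists_mem_dvd ha hd
      obtain ⟨q, hq, rfl⟩ := Multiset.mem_map.1 hr
      refine main _ (lin q (hM q hq) (hMℓ q hq)) hvr ?_
      rw [hφlin q (hM q hq).2]
      exact Submodule.sub_mem _ (Submodule.span_mono hS (hMs (Set.mem_insert_of_mem _ hq)))
        (Submodule.smul_mem _ _ hℓS)
    · rw [hht] at hd
      obtain ⟨r, hr, hvr⟩ := hφv.exists_mem_dvd hb hd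
      refine main r (htlin r hr).1 hvr (Submodule.span_le.2 ?_ (hp r hr))
      rintro x (rfl | rfl)
      exacts [hℓS, hpS]
  have hfin : Module.finrank F
      ↥(Submodule.span F {ℓ : MvPolynomial (Fin n) F | IsLinearForm ℓ ∧ ℓ ∣ T₂}) ≤ B.card + 2 :=
    (Submodule.finrank_mono hle).trans ((finrank_span_finset_le_card S).trans
      ((Finset.card_insert_le _ _).trans (Nat.succ_le_succ (Finset.card_insert_le _ _))))
  have hm0 : (0 : ℝ) < m := by exact_mod_cast hm
  have hlog : (B.card : ℝ) ≤ Real.logb 2 m + 1 := by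
    have h2 : (2 : ℝ) ^ B.card ≤ 2 * m := by exact_mod_cast hBcard
    have := Real.logb_le_logb_of_le one_lt_two (by positivity) h2
    rw [Real.logb_mul two_ne_zero hm0.ne', Real.logb_pow, Real.logb_self_eq_one one_lt_two] at this
    linarith
  have hfin' : (Module.finrank F ↥(Submodule.span F
      {ℓ : MvPolynomial (Fin n) F | IsLinearForm ℓ ∧ ℓ ∣ T₂}) : ℝ) ≤ B.card + 2 := by
    exact_mod_cast hfin
  linarith

end LinearForms

/-- If the linear factors of each gate `Tᵢ` span a space of dimension at least
`log₂ m + 5`, then every linear factor of `T₁·T₂` is (up to scalar) a candidate linear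
form for `NonLin(f)`. -/
theorem all_gate_factors_are_candidates_high_dim
    {F : Type*} [Field F] [Fintype F] {n m : ℕ}
    (G T₁ T₂ f h : MvPolynomial (Fin n) F)
    (hm : 1 ≤ m)
    (hG : IsProdLinearForms G) (hT₁ : IsProdLinearForms T₁) (hT₂ : IsProdLinearForms T₂)
    (hT₁hom : T₁.IsHomogeneous m) (hT₂hom : T₂.IsHomogeneous m)
    (hgcd : ∀ ℓ : MvPolynomial (Fin n) F, IsLinearForm ℓ → ℓ ∣ T₁ → ¬ ℓ ∣ T₂)
    (hdim₁ : Real.logb 2 (m : ℝ) + 5 ≤ (Module.finrank F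
      ↥(Submodule.span F {ℓ : MvPolynomial (Fin n) F | IsLinearForm ℓ ∧ ℓ ∣ T₁}) : ℝ))
    (hdim₂ : Real.logb 2 (m : ℝ) + 5 ≤ (Module.finrank F
      ↥(Submodule.span F {ℓ : MvPolynomial (Fin n) F | IsLinearForm ℓ ∧ ℓ ∣ T₂}) : ℝ))
    (hf : f = G * (T₁ + T₂)) (hh : IsNonLinPart f h) :
    ∀ ℓ : MvPolynomial (Fin n) F, IsLinearForm ℓ → ℓ ∣ T₁ * T₂ →
      ∃ c : F, c ≠ 0 ∧ IsCandidateLinearForm h (c • ℓ) := by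
  intro ℓ hℓ hℓT
  obtain ⟨hhlin, L, ⟨a, M, ha, hM, rfl⟩, hL⟩ := hh
  obtain ⟨c, N, hc, hN, rfl⟩ := hG
  have heq : N.prod * (T₁ + T₂) = C (c⁻¹ * a) * M.prod * h := by
    rw [C_mul, mul_assoc, mul_assoc (C _) (C a), ← mul_assoc (C a), ← smul_eq_C_mul M.prod, ← hL,
      hf, smul_mul_assoc, ← smul_eq_C_mul, smul_smul, inv_mul_cancel₀ hc, one_smul]
  obtain ⟨b, t, hb, ht, hsum⟩ := exists_eq_C_mul_prod_mul_of_prod_mul_eq hhlin N hN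
    (mul_ne_zero (inv_ne_zero hc) ha) M hM heq
  refine ⟨1, one_ne_zero, ?_⟩
  rw [one_smul]
  rcases hℓ.prime.dvd_or_dvd hℓT with h₁ | h₂
  · exact isCandidateLinearForm_of_dvd hm hT₁ hT₂ hT₁hom hT₂hom hgcd (by linarith) hb ht hsum hℓ h₁
  · exact isCandidateLinearForm_of_dvd hm hT₂ hT₁ hT₂hom hT₁hom (fun p hp h2 h1 => hgcd p hp h1 h2)
      (by linarith) hb ht (by rw [add_comm, hsum]) hℓ h₂
end

section
/- Let ℓ_1, ℓ_2, ℓ_1′, ℓ_2′ be homogeneous degree-1 polynomials (possibly zero) in the F-span of x_3, x_4, x_5, and suppose (ℓ_1, ℓ_2) ≠ (ℓ_1′, ℓ_2′). For scalars α, β ∈ F, let Δ_{α,β} be the F-algebra substitution fixing x_3 and x_4 and sending x_5 ↦ x_5 + α·x_3 + β·x_4. Then there is at most one pair (α, β) ∈ F² for which (Δ_{α,β}(ℓ_1)|_{x_5=0}, Δ_{α,β}(ℓ_2)|_{x_5=0}) = (Δ_{α,β}(ℓ_1′)|_{x_5=0}, Δ_{α,β}(ℓ_2′)|_{x_5=0}),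 where |_{x_5=0} denotes setting x_5 = 0. -/
open MvPolynomial

/-- A linear form killed by the substitutions `X 2 ↦ α * X 0 + β * X 1` for two distinct
pairs `(α, β)` is zero. -/
theorem eq_zero_or_eq_of_aeval_shift_eq_zero {F : Type*} [Field F]
    {m : MvPolynomial (Fin 3) F}
    (hm : m ∈ Submodule.span F (Set.range (X : Fin 3 → MvPolynomial (Fin 3) F)))
    {p q : F × F}
    (hp : (aeval ![(X 0 : MvPolynomial (Fin 3) F), X 1, 0])
      ((aeval ![(X 0 : MvPolynomial (Fin 3) F), X 1,
        X 2 + C p.1 * X 0 + C p.2 * X 1]) m) = 0)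
    (hq : (aeval ![(X 0 : MvPolynomial (Fin 3) F), X 1, 0])
      ((aeval ![(X 0 : MvPolynomial (Fin 3) F), X 1,
        X 2 + C q.1 * X 0 + C q.2 * X 1]) m) = 0) :
    m = 0 ∨ p = q := by
  obtain ⟨c, rfl⟩ := (Submodule.mem_span_range_iff_exists_fun F).1 hm
  have coeffs (r : F × F) (hr : (aeval ![(X 0 : MvPolynomial (Fin 3) F), X 1, 0])
      ((aeval ![(X 0 : MvPolynomial (Fin 3) F), X 1,
        X 2 + C r.1 * X 0 + C r.2 * X 1]) (∑ i, c i • (X i : MvPolynomial (Fin 3) F))) = 0) :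
      c 0 + c 2 * r.1 = 0 ∧ c 1 + c 2 * r.2 = 0 := by
    simp only [Fin.sum_univ_three, map_add, map_smul, aeval_X, map_mul, Matrix.cons_val,
      algHom_C, algebraMap_eq] at hr
    have h0 := congrArg (eval ![1, 0, 0]) hr
    have h1 := congrArg (eval ![0, 1, 0]) hr
    simp [smul_eval] at h0 h1
    exact ⟨h0, h1⟩
  obtain ⟨hp0, hp1⟩ := coeffs p hp
  obtain ⟨hq0, hq1⟩ := coeffs q hq
  by_cases h2 : c 2 = 0
  · left
    simp only [h2, zero_mul, add_zero] at hp0 hp1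
    simp [Fin.sum_univ_three, hp0, hp1, h2]
  · right
    exact Prod.ext (mul_left_cancel₀ h2 (add_left_cancel (hp0.trans hq0.symm)))
      (mul_left_cancel₀ h2 (add_left_cancel (hp1.trans hq1.symm)))

/-- In `F[x₃,x₄,x₅]` (variables `X 0 = x₃`, `X 1 = x₄`, `X 2 = x₅`): given two distinct
pairs `(ℓ₁,ℓ₂) ≠ (ℓ₁',ℓ₂')` of (possibly zero) degree-1 forms in the span of the
variables, there is at most one pair `(α,β) ∈ F²` for which the substitution
`Δ_{α,β} : x₅ ↦ x₅ + α·x₃ + β·x₄` followed by setting `x₅ = 0` makes the two pairs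
coincide. -/
theorem at_most_one_collision_after_random_shift
    {F : Type*} [Field F] [Fintype F]
    (ℓ₁ ℓ₂ ℓ₁' ℓ₂' : MvPolynomial (Fin 3) F)
    (h₁ : ℓ₁ ∈ Submodule.span F (Set.range (X : Fin 3 → MvPolynomial (Fin 3) F)))
    (h₂ : ℓ₂ ∈ Submodule.span F (Set.range (X : Fin 3 → MvPolynomial (Fin 3) F)))
    (h₁' : ℓ₁' ∈ Submodule.span F (Set.range (X : Fin 3 → MvPolynomial (Fin 3) F)))
    (h₂' : ℓ₂' ∈ Submodule.span F (Set.range (X : Fin 3 → MvPolynomial (Fin 3) F)))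
    (hne : (ℓ₁, ℓ₂) ≠ (ℓ₁', ℓ₂')) :
    Set.Subsingleton {p : F × F |
      (aeval ![(X 0 : MvPolynomial (Fin 3) F), X 1, 0])
          ((aeval ![(X 0 : MvPolynomial (Fin 3) F), X 1,
            X 2 + C p.1 * X 0 + C p.2 * X 1]) ℓ₁) =
        (aeval ![(X 0 : MvPolynomial (Fin 3) F), X 1, 0])
          ((aeval ![(X 0 : MvPolynomial (Fin 3) F), X 1,
            X 2 + C p.1 * X 0 + C p.2 * X 1]) ℓ₁') ∧
      (aeval ![(X 0 : MvPolynomial (Fin 3) F), X 1, 0])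
          ((aeval ![(X 0 : MvPolynomial (Fin 3) F), X 1,
            X 2 + C p.1 * X 0 + C p.2 * X 1]) ℓ₂) =
        (aeval ![(X 0 : MvPolynomial (Fin 3) F), X 1, 0])
          ((aeval ![(X 0 : MvPolynomial (Fin 3) F), X 1,
            X 2 + C p.1 * X 0 + C p.2 * X 1]) ℓ₂')} := by
  rintro p ⟨hp₁, hp₂⟩ q ⟨hq₁, hq₂⟩
  by_contra hpq
  refine hne (Prod.ext (sub_eq_zero.1 ?_) (sub_eq_zero.1 ?_))
  · exact (eq_zero_or_eq_of_aeval_shift_eq_zero (sub_mem h₁ h₁')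
      (by simp only [map_sub, hp₁, sub_self])
      (by simp only [map_sub, hq₁, sub_self])).resolve_right hpq
  · exact (eq_zero_or_eq_of_aeval_shift_eq_zero (sub_mem h₂ h₂')
      (by simp only [map_sub, hp₂, sub_self])
      (by simp only [map_sub, hq₂, sub_self])).resolve_right hpq
end
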